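/- arXiv:1301.2507 — 2 statements merged into one kernel-verified Lean document; each statement's English description precedes it below -/
import Mathlib

section
/- Let M be a von Neumann algebra and π : M → M a unital *-homomorphism (a unital representation of M into itself). Then π is an extremal element of the convex set CP of unital completely positive maps on M, i.e. if π = λτ₀ + (1−λ)τ₁ with τ₀, τ₁ ∈ CP and λ ∈ (0,1), then τ₀ = τ₁ = π. -/
set_option synthInstance.maxHeartbeats 1000000
set_option maxHeartbeats 1000000

open scoped ComplexOrder InnerProductSpace
open ContinuousLinearMap NormedSpace

noncomputable section

namespace Paper

instance {H : Type*} [NormedAddCommGroup H] [InnerProductSpace ℂ H] [CompleteSpace H] :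
    SMulMemClass (VonNeumannAlgebra H) ℂ (H →L[ℂ] H) where
  smul_mem {M} c _x hx := M.toStarSubalgebra.smul_mem hx c

instance {H : Type*} [NormedAddCommGroup H] [InnerProductSpace ℂ H] [CompleteSpace H]
    (M : VonNeumannAlgebra H) : CStarRing ↥M where
  norm_mul_self_le x := by
    have := CStarRing.norm_mul_self_le (x : H →L[ℂ] H)
    simpa using this

/-- A map from a star ring into the bounded operators on a Hilbert space is completely
positive if all the canonical matrices it produces are positive. -/
def IsCPMap {H : Type*} [NormedAddCommGroup H] [InnerProductSpace ℂ H]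
    {A : Type*} [NonUnitalRing A] [StarRing A] (φ : A → (H →L[ℂ] H)) : Prop :=
  ∀ (n : ℕ) (a : Fin n → A) (ξ : Fin n → H),
    0 ≤ ∑ i, ∑ j, ⟪ξ i, (φ (star (a i) * a j)) (ξ j)⟫_ℂ

variable {H : Type*} [NormedAddCommGroup H] [InnerProductSpace ℂ H] [CompleteSpace H]

/-- The Schwarz inequality for unital completely positive maps, in vector form. -/
theorem IsCPMap.norm_apply_sq_le {A : Type*} [Ring A] [StarRing A]
    {φ : A → (H →L[ℂ] H)} (hφ : IsCPMap φ) (h1 : φ 1 = 1) (x : A) (ζ : H) :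
    ‖φ x ζ‖ ^ 2 ≤ (⟪ζ, φ (star x * x) ζ⟫_ℂ).re := by
  have key : ∀ η : H, 0 ≤ ⟪η, η⟫_ℂ + ⟪η, φ x ζ⟫_ℂ
      + (⟪ζ, φ (star x) η⟫_ℂ + ⟪ζ, φ (star x * x) ζ⟫_ℂ) := by
    intro η
    simpa [Fin.sum_univ_two, h1] using hφ 2 ![1, x] ![η, ζ]
  have him : (⟪ζ, φ (star x * x) ζ⟫_ℂ).im = 0 := by
    have := (Complex.nonneg_iff.mp (key 0)).2
    simpa using this.symm
  have hre : (⟪φ x ζ, φ x ζ⟫_ℂ).re = (⟪ζ, φ (star x) (φ x ζ)⟫_ℂ).re := by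
    have := (Complex.nonneg_iff.mp (key (Complex.I • φ x ζ))).2
    simp only [map_smul, inner_smul_left, inner_smul_right, inner_self_eq_norm_sq_to_K,
      Complex.add_im, him] at this
    simp only [inner_self_eq_norm_sq_to_K]
    simp [← Complex.ofReal_pow] at this ⊢
    linarith
  have h := (Complex.nonneg_iff.mp (key (-φ x ζ))).1
  simp only [map_neg, inner_neg_left, inner_neg_right, neg_neg, Complex.add_re,
    Complex.neg_re, ← hre] at h
  have hn : (⟪φ x ζ, φ x ζ⟫_ℂ).re = ‖φ x ζ‖ ^ 2 := inner_self_eq_norm_sq (𝕜 := ℂ) _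
  linarith

/-- Strict convexity of the squared norm on an inner product space. -/
theorem eq_of_convex_comb_norm_sq_le {l : ℝ} (hl₀ : 0 < l) (hl₁ : l < 1) {u v : H}
    (h : l * ‖u‖ ^ 2 + (1 - l) * ‖v‖ ^ 2 ≤ ‖(l : ℂ) • u + ((1 - l : ℝ) : ℂ) • v‖ ^ 2) :
    u = v := by
  have e₁ := norm_add_sq (𝕜 := ℂ) ((l : ℂ) • u) (((1 - l : ℝ) : ℂ) • v)
  have e₂ := norm_sub_sq (𝕜 := ℂ) u v
  simp only [inner_smul_left, inner_smul_right, Complex.conj_ofReal, norm_smul,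
    Complex.norm_real, Real.norm_eq_abs, abs_of_pos hl₀, abs_of_pos (sub_pos.2 hl₁),
    RCLike.re_to_complex, Complex.re_ofReal_mul] at e₁ e₂
  have hle : l * (1 - l) * ‖u - v‖ ^ 2 ≤ 0 := by
    rw [e₂]
    linarith
  have hpos : 0 < l * (1 - l) := mul_pos hl₀ (sub_pos.2 hl₁)
  have hz : ‖u - v‖ ^ 2 ≤ 0 := nonpos_of_mul_nonpos_right hle hpos
  have hz' : ‖u - v‖ = 0 := by simpa using le_antisymm hz (sq_nonneg _)
  exact sub_eq_zero.1 (norm_eq_zero.1 hz')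

/-- Unital *-homomorphisms are extremal in the convex set of unital completely positive
maps on a von Neumann algebra: if `π = λ τ₀ + (1 - λ) τ₁` with `τ₀, τ₁` unital
completely positive and `λ ∈ (0,1)`, then `τ₀ = τ₁ = π`. -/
theorem stmt_7 (M : VonNeumannAlgebra H) (π : ↥M →⋆ₐ[ℂ] ↥M)
    (τ₀ τ₁ : ↥M →ₗ[ℂ] ↥M)
    (h₀cp : IsCPMap (fun x => ((τ₀ x : ↥M) : H →L[ℂ] H)))
    (h₁cp : IsCPMap (fun x => ((τ₁ x : ↥M) : H →L[ℂ] H)))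
    (h₀u : τ₀ 1 = 1) (h₁u : τ₁ 1 = 1)
    (l : ℝ) (hl₀ : 0 < l) (hl₁ : l < 1)
    (hcomb : ∀ x : ↥M, π x = (l : ℂ) • τ₀ x + ((1 - l : ℝ) : ℂ) • τ₁ x) :
    ∀ x : ↥M, τ₀ x = π x ∧ τ₁ x = π x := by
  have hval : ∀ (x : ↥M) (ζ : H), (π x : H →L[ℂ] H) ζ
      = (l : ℂ) • (τ₀ x : H →L[ℂ] H) ζ + ((1 - l : ℝ) : ℂ) • (τ₁ x : H →L[ℂ] H) ζ := by
    intro x ζ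
    rw [hcomb x]
    rfl
  have heq : ∀ x : ↥M, τ₀ x = τ₁ x := by
    intro x
    refine Subtype.ext (ContinuousLinearMap.ext fun ζ => ?_)
    refine eq_of_convex_comb_norm_sq_le hl₀ hl₁ ?_
    have s₀ := h₀cp.norm_apply_sq_le (by simp [h₀u]) x ζ
    have s₁ := h₁cp.norm_apply_sq_le (by simp [h₁u]) x ζ
    have hπ : ⟪ζ, (π (star x * x) : H →L[ℂ] H) ζ⟫_ℂ
        = ⟪(π x : H →L[ℂ] H) ζ, (π x : H →L[ℂ] H) ζ⟫_ℂ := by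
      rw [map_mul, map_star]
      exact ContinuousLinearMap.adjoint_inner_right (π x : H →L[ℂ] H) ζ _
    have hn : (⟪(π x : H →L[ℂ] H) ζ, (π x : H →L[ℂ] H) ζ⟫_ℂ).re
        = ‖(π x : H →L[ℂ] H) ζ‖ ^ 2 := inner_self_eq_norm_sq (𝕜 := ℂ) _
    rw [← hval, ← hn, ← hπ, hval, inner_add_right, inner_smul_right, inner_smul_right,
      Complex.add_re, Complex.re_ofReal_mul, Complex.re_ofReal_mul]
    exact add_le_add (mul_le_mul_of_nonneg_left s₀ hl₀.le)
      (mul_le_mul_of_nonneg_left s₁ (sub_pos.2 hl₁).le)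
  have hτ : ∀ x : ↥M, π x = τ₁ x := by
    intro x
    rw [hcomb x, heq x, ← add_smul, ← Complex.ofReal_add, add_sub_cancel,
      Complex.ofReal_one, one_smul]
  exact fun x => ⟨(heq x).trans (hτ x).symm, (hτ x).symm⟩

end Paper
end
end

section
/- Let A be a unital C*-algebra, τ : A → B(H) a unital completely positive map, and τ(x) = V π(x) V* its minimal Stinespring representation. Then the following are equivalent: (a) τ is extremal in the convex set CP of unital completely positive maps from A to B(H); (b) for Λ ∈ π(A)', V Λ V* = 0 implies Λ = 0. -/
set_option synthInstance.maxHeartbeats 1000000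
set_option maxHeartbeats 1000000

open scoped ComplexOrder InnerProductSpace
open ContinuousLinearMap NormedSpace

noncomputable section

namespace Paper

/-- `τ` is extremal in the convex set of unital completely positive maps from `A` to
`B(H)`: any way of writing `τ` as a proper convex combination of two unital completely
positive maps forces both of them to equal `τ`. -/
def IsExtremalUCP {H : Type*} [NormedAddCommGroup H] [InnerProductSpace ℂ H]
    {A : Type*} [NormedRing A] [StarRing A] [NormedAlgebra ℂ A]
    (τ : A → (H →L[ℂ] H)) : Prop :=
  ∀ (τ₀ τ₁ : A →ₗ[ℂ] (H →L[ℂ] H)) (l : ℝ), 0 < l → l < 1 →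
    IsCPMap ⇑τ₀ → IsCPMap ⇑τ₁ → τ₀ 1 = 1 → τ₁ 1 = 1 →
    (∀ x : A, τ x = (l : ℂ) • τ₀ x + ((1 - l : ℝ) : ℂ) • τ₁ x) →
    ∀ x : A, τ₀ x = τ x ∧ τ₁ x = τ x

variable {H K : Type*} [NormedAddCommGroup H] [InnerProductSpace ℂ H] [CompleteSpace H]
  [NormedAddCommGroup K] [InnerProductSpace ℂ K] [CompleteSpace K]

/-- The nonnegativity defining complete positivity, for a family indexed by any finset. -/
theorem IsCPMap.sum_nonneg {H A ι : Type*} [NormedAddCommGroup H] [InnerProductSpace ℂ H]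
    [NonUnitalRing A] [StarRing A] {φ : A → (H →L[ℂ] H)} (hφ : IsCPMap φ)
    (s : Finset ι) (a : ι → A) (ξ : ι → H) :
    0 ≤ ∑ i ∈ s, ∑ j ∈ s, ⟪ξ i, φ (star (a i) * a j) (ξ j)⟫_ℂ := by
  have h := hφ s.card (fun i ↦ a (s.equivFin.symm i)) (fun i ↦ ξ (s.equivFin.symm i))
  rw [← Finset.sum_coe_sort s]
  simp_rw [← Finset.sum_coe_sort s (fun j ↦ ⟪ξ _, φ (star (a _) * a j) (ξ j)⟫_ℂ)]
  rw [← s.equivFin.symm.sum_comp]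
  simp_rw [← s.equivFin.symm.sum_comp (fun j : s ↦ ⟪ξ _, φ (star (a _) * a j) (ξ j)⟫_ℂ)]
  exact h

/-- A completely positive map is compatible with the adjoint on products `x⋆ y`. -/
theorem IsCPMap.inner_conj_symm {H A : Type*} [NormedAddCommGroup H] [InnerProductSpace ℂ H]
    [NonUnitalRing A] [StarRing A] {φ : A → (H →L[ℂ] H)} (hφ : IsCPMap φ)
    (x y : A) (v w : H) :
    ⟪v, φ (star x * y) w⟫_ℂ = ⟪φ (star y * x) v, w⟫_ℂ := by
  have him (u : H) :
      (⟪v, φ (star x * y) u⟫_ℂ).im + (⟪u, φ (star y * x) v⟫_ℂ).im = 0 := by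
    have h2 := (Complex.nonneg_iff.1 (hφ 2 ![x, y] ![v, u])).2
    have hx := (Complex.nonneg_iff.1 (hφ 1 ![x] ![v])).2
    have hy := (Complex.nonneg_iff.1 (hφ 1 ![y] ![u])).2
    simp [Fin.sum_univ_two] at h2 hx hy
    linarith
  have h1 := him w
  have h2 := him (Complex.I • w)
  simp only [map_smul, inner_smul_right, inner_smul_left, Complex.conj_I, Complex.mul_im,
    Complex.I_re, Complex.I_im, Complex.neg_re, Complex.neg_im] at h2
  rw [← _root_.inner_conj_symm (φ (star y * x) v) w]
  apply Complex.ext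
  · simp only [Complex.conj_re]; linarith
  · simp only [Complex.conj_im]; linarith

/-- The operator-valued kernel `(x, y) ↦ φ (x⋆ y)` of a completely positive map is positive
semidefinite. -/
theorem IsCPMap.posSemidef_kernel {H A : Type*} [NormedAddCommGroup H] [InnerProductSpace ℂ H]
    [CompleteSpace H] [NonUnitalRing A] [StarRing A] {φ : A → (H →L[ℂ] H)} (hφ : IsCPMap φ) :
    (Matrix.of fun x y : A ↦ φ (star x * y)).PosSemidef := by
  have h := (RKHS.posSemidef_tfae (𝕜 := ℂ) (X := A) (V := H)
    (K := Matrix.of fun x y : A ↦ φ (star x * y))).out 0 2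
  refine h.2 ⟨?_, fun vv ↦ ?_⟩
  · refine Matrix.ext fun x y ↦ ContinuousLinearMap.ext fun v ↦ ext_inner_right ℂ fun w ↦ ?_
    simp only [Matrix.conjTranspose_apply, Matrix.of_apply, star_eq_adjoint, adjoint_inner_left]
    exact hφ.inner_conj_symm y x v w
  · have h := (Complex.nonneg_iff.1 (hφ.sum_nonneg vv.support id vv)).1
    simp only [Finsupp.sum, Matrix.of_apply]
    rw [Finset.sum_comm]
    convert h using 1
    simp only [RCLike.re_to_complex, Complex.re_sum, id]
    refine Finset.sum_congr rfl fun x _ ↦ Finset.sum_congr rfl fun y _ ↦ ?_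
    rw [← _root_.inner_conj_symm, Complex.conj_re]

/-- An operator is determined by its matrix coefficients on the cyclic vectors `π x V⋆ f`. -/
theorem eq_of_inner_cyclic {A : Type*} [Ring A] [StarRing A] [Algebra ℂ A]
    (π : A →⋆ₐ[ℂ] (K →L[ℂ] K)) (V : K →L[ℂ] H)
    (hmin : Dense (Submodule.span ℂ {k : K | ∃ (x : A) (f : H), π x (adjoint V f) = k} : Set K))
    {P Q : K →L[ℂ] K}
    (h : ∀ x y f g, ⟪π x (adjoint V f), P (π y (adjoint V g))⟫_ℂ
      = ⟪π x (adjoint V f), Q (π y (adjoint V g))⟫_ℂ) : P = Q := by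
  refine ContinuousLinearMap.ext_on hmin ?_
  rintro _ ⟨y, g, rfl⟩
  refine hmin.eq_of_inner_right (𝕜 := ℂ) fun k hk ↦ ?_
  induction hk using Submodule.span_induction with
  | mem k hk => obtain ⟨x, f, rfl⟩ := hk; exact h x y f g
  | zero => simp
  | add k k' _ _ hk hk' => simp [inner_add_left, hk, hk']
  | smul c k _ hk => simp [inner_smul_left, hk]

/-- The kernel sums of `x ↦ V Λ (π x) V⋆`, with `Λ` in the commutant of `π`, are quadratic
form values of `Λ`. -/
theorem sum_inner_stinespring {A ι : Type*} [Ring A] [StarRing A] [Algebra ℂ A]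
    (π : A →⋆ₐ[ℂ] (K →L[ℂ] K)) (V : K →L[ℂ] H) {Λ : K →L[ℂ] K} (hΛ : ∀ x, Commute (π x) Λ)
    (s : Finset ι) (a : ι → A) (ξ : ι → H) :
    ∑ i ∈ s, ∑ j ∈ s, ⟪ξ i, V (Λ (π (star (a i) * a j) (adjoint V (ξ j))))⟫_ℂ
      = ⟪∑ i ∈ s, π (a i) (adjoint V (ξ i)), Λ (∑ i ∈ s, π (a i) (adjoint V (ξ i)))⟫_ℂ := by
  simp_rw [map_sum, sum_inner, inner_sum]
  refine Finset.sum_congr rfl fun i _ ↦ Finset.sum_congr rfl fun j _ ↦ ?_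
  have h := congr($((hΛ (star (a i))).eq) (π (a j) (adjoint V (ξ j))))
  simp only [mul_def, comp_apply] at h
  rw [map_mul, mul_def, comp_apply, ← h, map_star, star_eq_adjoint, ← adjoint_inner_left,
    adjoint_inner_right]

/-- **Radon–Nikodym derivative** of completely positive maps: if `φ` is dominated, as a kernel,
by a multiple of the map with minimal Stinespring representation `V π V⋆`, then
`φ x = V Λ (π x) V⋆` for some `Λ` in the commutant of `π`. -/
theorem IsCPMap.exists_commutant {A : Type*} [Ring A] [StarRing A] [Algebra ℂ A]
    {φ : A → (H →L[ℂ] H)} (hφ : IsCPMap φ) (π : A →⋆ₐ[ℂ] (K →L[ℂ] K)) (V : K →L[ℂ] H)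
    (hmin : Dense (Submodule.span ℂ {k : K | ∃ (x : A) (f : H), π x (adjoint V f) = k} : Set K))
    (C : ℝ)
    (hC : ∀ (s : Finset A) (ξ : A → H),
      (∑ x ∈ s, ∑ y ∈ s, ⟪ξ x, φ (star x * y) (ξ y)⟫_ℂ).re
        ≤ C ^ 2 * ‖∑ x ∈ s, π x (adjoint V (ξ x))‖ ^ 2) :
    ∃ Λ : K →L[ℂ] K, (∀ x, Commute (π x) Λ) ∧
      ∀ x f g, ⟪adjoint V f, Λ (π x (adjoint V g))⟫_ℂ = ⟪f, φ x g⟫_ℂ := by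
  let M : Matrix A A (H →L[ℂ] H) := .of fun x y ↦ φ (star x * y)
  have : Fact M.PosSemidef := ⟨hφ.posSemidef_kernel⟩
  let S : (A →₀ H) →ₗ[ℂ] RKHS.OfKernel M :=
    Finsupp.lsum ℂ fun x ↦ (RKHS.kerFun (RKHS.OfKernel M) x).toLinearMap
  let T : (A →₀ H) →ₗ[ℂ] K := Finsupp.lsum ℂ fun x ↦ ((π x).comp (adjoint V)).toLinearMap
  have inner_S (x y : A) (f g : H) :
      ⟪RKHS.kerFun (RKHS.OfKernel M) x f, RKHS.kerFun (RKHS.OfKernel M) y g⟫_ℂ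
        = ⟪f, φ (star x * y) g⟫_ℂ := by
    rw [RKHS.kerFun_inner, RKHS.kerFun_apply, RKHS.OfKernel.kernel_ofKernel]; rfl
  have hT : DenseRange T := by
    refine hmin.mono (Submodule.span_le (p := LinearMap.range T).2 ?_)
    rintro _ ⟨x, f, rfl⟩
    exact ⟨Finsupp.single x f, by simp [T]⟩
  have hST (u : A →₀ H) : ‖S u‖ ≤ |C| * ‖T u‖ := by
    refine le_of_sq_le_sq ?_ (by positivity)
    have h := hC u.support u
    have hS : S u = ∑ x ∈ u.support, RKHS.kerFun (RKHS.OfKernel M) x (u x) := by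
      simp [S, Finsupp.sum]
    rw [mul_pow, sq_abs, ← inner_self_eq_norm_sq (𝕜 := ℂ), hS]
    simp_rw [sum_inner, inner_sum, inner_S]
    simpa [T, Finsupp.sum] using h
  let W : K →L[ℂ] RKHS.OfKernel M := S.extendOfNorm T
  have hW (x : A) (f : H) : W (π x (adjoint V f)) = RKHS.kerFun (RKHS.OfKernel M) x f := by
    have := LinearMap.extendOfNorm_eq hT ⟨_, hST⟩ (Finsupp.single x f)
    simpa [S, T, W] using this
  refine ⟨(adjoint W).comp W, fun z ↦ ?_, fun x f g ↦ ?_⟩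
  · refine eq_of_inner_cyclic π V hmin fun x y f g ↦ ?_
    have hmul (x y : A) (f : H) : π x (π y (adjoint V f)) = π (x * y) (adjoint V f) := by
      rw [map_mul]; rfl
    have hadj (k k' : K) : ⟪k, π z k'⟫_ℂ = ⟪π (star z) k, k'⟫_ℂ := by
      rw [map_star, star_eq_adjoint, adjoint_inner_left]
    simp only [mul_def, comp_apply]
    rw [hadj]
    simp only [hmul, adjoint_inner_right, hW, inner_S, star_mul, star_star, mul_assoc]
  · have := hW 1 f
    rw [map_one] at this
    change W (adjoint V f) = _ at this
    rw [comp_apply, adjoint_inner_right, this, hW, inner_S]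
    simp

/-- If the compression `Λ ↦ V Λ V⋆` is injective on the commutant of `π`, then a unital completely
positive map which is dominated by `V π V⋆` equals it. -/
theorem IsCPMap.eq_of_dominated {A : Type*} [Ring A] [StarRing A] [Algebra ℂ A]
    {τ φ ψ : A → (H →L[ℂ] H)} (hφ : IsCPMap φ) (hψ : IsCPMap ψ)
    (hτu : τ 1 = 1) (hφu : φ 1 = 1)
    (π : A →⋆ₐ[ℂ] (K →L[ℂ] K)) (V : K →L[ℂ] H)
    (hτ : ∀ x, τ x = V.comp ((π x).comp (adjoint V)))
    (hmin : Dense (Submodule.span ℂ {k : K | ∃ (x : A) (f : H), π x (adjoint V f) = k} : Set K))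
    (hinj : ∀ Λ : K →L[ℂ] K, (∀ x : A, Commute (π x) Λ) →
      V.comp (Λ.comp (adjoint V)) = 0 → Λ = 0)
    {l m : ℝ} (hl : 0 < l) (hm : 0 < m) (hlm : ∀ x, τ x = (l : ℂ) • φ x + (m : ℂ) • ψ x) (x : A) :
    φ x = τ x := by
  obtain ⟨Λ, hΛ, hΛφ⟩ := hφ.exists_commutant π V hmin √l⁻¹ fun s ξ ↦ by
    have h := sum_inner_stinespring π V (fun x ↦ Commute.one_right (π x)) s id ξ
    have hτ' (x : A) (f : H) : V ((1 : K →L[ℂ] K) (π x (adjoint V f))) = τ x f := by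
      rw [hτ]; rfl
    simp_rw [hτ', hlm, add_apply, smul_apply, inner_add_right, inner_smul_right,
      Finset.sum_add_distrib, ← Finset.mul_sum] at h
    have hre := congr(Complex.re $h)
    have h0 := (Complex.nonneg_iff.1 (hψ.sum_nonneg s id ξ)).1
    change _ = RCLike.re ⟪_, _⟫_ℂ at hre
    rw [one_apply_eq_self, inner_self_eq_norm_sq, Complex.add_re, Complex.re_ofReal_mul,
      Complex.re_ofReal_mul] at hre
    simp only [id] at hre h0
    rw [Real.sq_sqrt (by positivity), ← hre, le_inv_mul_iff₀ hl]
    nlinarith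
  have hV : V.comp (adjoint V) = 1 := by
    rw [← hτu, hτ, map_one]; rfl
  have hΛ1 : Λ - 1 = 0 := by
    refine hinj _ (fun x ↦ (hΛ x).sub_right (Commute.one_right _)) ?_
    refine ContinuousLinearMap.ext fun g ↦ ext_inner_left ℂ fun f ↦ ?_
    have h1 := hΛφ 1 f g
    have h2 : V (adjoint V g) = g := congr($hV g)
    rw [map_one, hφu, adjoint_inner_left] at h1
    simp only [comp_apply, sub_apply, map_sub, inner_sub_right]
    change ⟪f, V (Λ (adjoint V g))⟫_ℂ - ⟪f, V (adjoint V g)⟫_ℂ = ⟪f, 0⟫_ℂ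
    rw [h2, inner_zero_right, sub_eq_zero]
    exact h1
  refine ContinuousLinearMap.ext fun g ↦ ext_inner_left ℂ fun f ↦ ?_
  rw [← hΛφ, sub_eq_zero.1 hΛ1, adjoint_inner_left, hτ]
  rfl

/-- If `V π V⋆` is extremal, then the compression `Λ ↦ V Λ V⋆` is injective on the self-adjoint
part of the commutant of `π`. -/
theorem IsExtremalUCP.eq_zero_of_isSelfAdjoint {A : Type*} [NormedRing A] [StarRing A]
    [NormedAlgebra ℂ A] {τ : A → (H →L[ℂ] H)} (hext : IsExtremalUCP τ) (hτu : τ 1 = 1)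
    (π : A →⋆ₐ[ℂ] (K →L[ℂ] K)) (V : K →L[ℂ] H)
    (hτ : ∀ x, τ x = V.comp ((π x).comp (adjoint V)))
    (hmin : Dense (Submodule.span ℂ {k : K | ∃ (x : A) (f : H), π x (adjoint V f) = k} : Set K))
    {Λ : K →L[ℂ] K} (hsa : IsSelfAdjoint Λ) (hΛ : ∀ x, Commute (π x) Λ)
    (hVΛ : V.comp (Λ.comp (adjoint V)) = 0) : Λ = 0 := by
  let θ (P : K →L[ℂ] K) : A →ₗ[ℂ] (H →L[ℂ] H) :=
    { toFun x := V.comp ((P.comp (π x)).comp (adjoint V))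
      map_add' x y := by simp [comp_add, add_comp]
      map_smul' c x := by simp }
  have hθ (P : K →L[ℂ] K) (x : A) : θ P x = V.comp ((P.comp (π x)).comp (adjoint V)) := rfl
  have hcp (P : K →L[ℂ] K) (hP : P.IsPositive) (hc : ∀ x, Commute (π x) P) : IsCPMap (θ P) := by
    intro n a ξ
    have h := sum_inner_stinespring π V hc Finset.univ a ξ
    simp only [hθ, comp_apply]
    rw [h]
    exact hP.inner_nonneg_right _
  have hpos (c : ℝ) (hc : |c| * ‖Λ‖ ≤ 1) : (1 + (c : ℂ) • Λ).IsPositive := by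
    refine isPositive_def'.2 ⟨(IsSelfAdjoint.one _).add (.smul (Complex.conj_ofReal c) hsa),
      fun k ↦ ?_⟩
    have h1 : ‖(c : ℂ) • ⟪Λ k, k⟫_ℂ‖ ≤ ‖k‖ ^ 2 := calc
      _ ≤ |c| * (‖Λ‖ * ‖k‖ * ‖k‖) := by
        rw [norm_smul, Complex.norm_real, Real.norm_eq_abs]
        gcongr
        exact (norm_inner_le_norm _ _).trans (by gcongr; exact Λ.le_opNorm k)
      _ = |c| * ‖Λ‖ * ‖k‖ ^ 2 := by ring
      _ ≤ 1 * ‖k‖ ^ 2 := by gcongr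
      _ = _ := one_mul _
    have h2 := (abs_le.1 ((Complex.abs_re_le_norm _).trans h1)).1
    rw [reApplyInnerSelf_apply, add_apply, smul_apply, one_apply_eq_self, inner_add_left,
      inner_smul_left, Complex.conj_ofReal, map_add, inner_self_eq_norm_sq]
    change _ ≤ RCLike.re ((c : ℂ) * ⟪Λ k, k⟫_ℂ) at h2
    linarith
  have hθτ (c : ℂ) (x : A) :
      θ (1 + c • Λ) x = τ x + c • V.comp ((Λ * π x).comp (adjoint V)) := by
    rw [hθ, hτ]
    ext f
    simp
  have hu (c : ℂ) : θ (1 + c • Λ) 1 = 1 := by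
    rw [hθτ, map_one, mul_one, hVΛ, smul_zero, add_zero, hτu]
  let c : ℝ := (1 + ‖Λ‖)⁻¹
  have hc : 0 < c := by positivity
  have hcΛ : c * ‖Λ‖ ≤ 1 := by
    rw [inv_mul_le_one₀ (by positivity)]; linarith
  have hcomm (c : ℂ) (x : A) : Commute (π x) (1 + c • Λ) :=
    (Commute.one_right _).add_right ((hΛ x).smul_right c)
  have key := hext (θ (1 + (c : ℂ) • Λ)) (θ (1 + ((-c : ℝ) : ℂ) • Λ)) (1 / 2) (by norm_num)
    (by norm_num) (hcp _ (hpos c (by rwa [abs_of_pos hc])) (hcomm _))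
    (hcp _ (hpos (-c) (by rwa [abs_neg, abs_of_pos hc])) (hcomm _)) (hu _) (hu _) fun x ↦ by
      rw [hθτ, hθτ]
      push_cast
      module
  have hzero (x : A) : V.comp ((Λ * π x).comp (adjoint V)) = 0 := by
    have h := (key x).1
    rw [hθτ, add_eq_left, smul_eq_zero] at h
    exact h.resolve_left (by exact_mod_cast hc.ne')
  refine eq_of_inner_cyclic π V hmin fun x y f g ↦ ?_
  have h1 := congr($((hΛ (star x)).eq) (π y (adjoint V g)))
  have h2 := congr($(hzero (star x * y)) g)
  simp only [map_mul, mul_def, comp_apply, zero_apply] at h1 h2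
  rw [← adjoint_inner_right, ← star_eq_adjoint, ← map_star, h1, adjoint_inner_left, h2]
  simp

/-- **Theorem 2.8.**  Let `A` be a unital C*-algebra, `τ : A → B(H)` a unital completely
positive map with minimal Stinespring representation `τ (x) = V π(x) V*`.  The following
are equivalent: (a) `τ` is extremal in the convex set of unital completely positive
maps; (b) for `Λ ∈ π(A)'`, `V Λ V* = 0` implies `Λ = 0`. -/
theorem stmt_10
    (A : Type*) [NormedRing A] [StarRing A] [CStarRing A]
    [NormedAlgebra ℂ A] [StarModule ℂ A] [CompleteSpace A]
    (τ : A → (H →L[ℂ] H)) (hτu : τ 1 = 1)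
    -- minimal Stinespring data for `τ`
    (π : A →⋆ₐ[ℂ] (K →L[ℂ] K)) (V : K →L[ℂ] H)
    (hτ : ∀ x : A, τ x = V.comp ((π x).comp (ContinuousLinearMap.adjoint V)))
    (hmin : Dense (Submodule.span ℂ
      {k : K | ∃ (x : A) (f : H), (π x) ((ContinuousLinearMap.adjoint V) f) = k} :
        Set K)) :
    IsExtremalUCP τ ↔
      ∀ Λ : K →L[ℂ] K, (∀ x : A, Commute (π x) Λ) →
        V.comp (Λ.comp (ContinuousLinearMap.adjoint V)) = 0 → Λ = 0 := by
  constructor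
  · intro hext Λ hΛ hVΛ
    have hstar (x : A) : Commute (π x) (star Λ) := by
      simpa [← map_star] using (hΛ (star x)).star_star
    have hVstar : V.comp ((star Λ).comp (adjoint V)) = 0 := by
      have h := congr(adjoint $hVΛ)
      rwa [adjoint_comp, adjoint_comp, adjoint_adjoint, map_zero, comp_assoc] at h
    have hre : Λ + star Λ = 0 :=
      hext.eq_zero_of_isSelfAdjoint hτu π V hτ hmin (.add_star_self Λ)
        (fun x ↦ (hΛ x).add_right (hstar x)) (by rw [add_comp, comp_add, hVΛ, hVstar, add_zero])
    have him : Complex.I • (Λ - star Λ) = 0 := by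
      refine hext.eq_zero_of_isSelfAdjoint hτu π V hτ hmin ?_
        (fun x ↦ ((hΛ x).sub_right (hstar x)).smul_right _)
        (by rw [smul_comp, comp_smul, sub_comp, comp_sub, hVΛ, hVstar, sub_zero, smul_zero])
      rw [isSelfAdjoint_iff, star_smul, star_sub, star_star, Complex.star_def, Complex.conj_I,
        neg_smul, ← smul_neg, neg_sub]
    have hsub := (smul_eq_zero.1 him).resolve_left Complex.I_ne_zero
    rw [← sub_eq_zero.1 hsub, ← two_smul ℂ] at hre
    exact (smul_eq_zero.1 hre).resolve_left two_ne_zero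
  · intro hinj τ₀ τ₁ l hl hl1 h₀ h₁ h₀u h₁u hcomb x
    exact ⟨h₀.eq_of_dominated h₁ hτu h₀u π V hτ hmin hinj hl (sub_pos.2 hl1) hcomb x,
      h₁.eq_of_dominated h₀ hτu h₁u π V hτ hmin hinj (sub_pos.2 hl1) hl
        (fun x ↦ (hcomb x).trans (add_comm _ _)) x⟩

end Paper
end
end
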